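/- For j = 1,…,q let (N_j,ρ_j) be a proper geodesic metric space with basepoint b_j such that every horofunction of (N_j,ρ_j) is a Busemann point and δ(h_j,h_j') = ∞ for every pair of distinct Busemann points h_j ≠ h_j' of (N_j,ρ_j). Then for every horofunction h of the product (∏_{j=1}^q N_j, d_∞) with basepoint b = (b_1,…,b_q) there exists a non-empty J ⊆ {1,…,q} such that the part (P(h), δ) is isometric to (ℝ^J/Sp(𝟏), ‖·‖_var); concretely, there is a bijection ψ from S = {β ∈ ℝ^J : min_{j∈J} β_j = 0} onto P(h) with δ(ψ(β), ψ(β')) = max_{j∈J}(β_j − β'_j) + max_{j∈J}(β'_j − β_j) for all β, β' ∈ S. -/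

import Mathlib

open Filter Topology

noncomputable section

/-- `horo b y z = d(z,y) - d(b,y)`, the function `h_y` with basepoint `b`. -/
def horo {M : Type*} [MetricSpace M] (b y z : M) : ℝ := dist z y - dist b y

/-- `HoroLim b y h` : the functions `h_{y^n}` (with basepoint `b`) converge pointwise to `h`. -/
def HoroLim {M : Type*} [MetricSpace M] (b : M) (y : ℕ → M) (h : M → ℝ) : Prop :=
  ∀ z : M, Filter.Tendsto (fun n => horo b (y n) z) Filter.atTop (nhds (h z))

/-- `h` is a horofunction of `(M,d)` with basepoint `b`. -/
def IsHorofunction {M : Type*} [MetricSpace M] (b : M) (h : M → ℝ) : Prop :=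
  (∃ y : ℕ → M, HoroLim b y h) ∧ ∀ y : M, h ≠ horo b y

/-- A metric space is geodesic: any two points are joined by a geodesic path. -/
def IsGeodesicSpace (M : Type*) [MetricSpace M] : Prop :=
  ∀ x y : M, ∃ γ : ℝ → M, γ 0 = x ∧ γ (dist x y) = y ∧
    ∀ s ∈ Set.Icc (0 : ℝ) (dist x y), ∀ t ∈ Set.Icc (0 : ℝ) (dist x y),
      dist (γ s) (γ t) = |s - t|

/-- Almost geodesic sequence. -/
def IsAlmostGeodesicSeq {M : Type*} [MetricSpace M] (y : ℕ → M) : Prop :=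
  Filter.Tendsto (fun n => dist (y n) (y 0)) Filter.atTop Filter.atTop ∧
  ∀ ε > (0 : ℝ), ∃ N : ℕ, ∀ m k : ℕ, N ≤ k → k ≤ m →
    dist (y m) (y k) + dist (y k) (y 0) - dist (y m) (y 0) < ε

/-- A Busemann point: a horofunction that is the limit of an almost geodesic sequence. -/
def IsBusemannPoint {M : Type*} [MetricSpace M] (b : M) (h : M → ℝ) : Prop :=
  IsHorofunction b h ∧ ∃ y : ℕ → M, IsAlmostGeodesicSeq y ∧ HoroLim b y h

/-- Detour cost `H(h₁,h₂)`, with values in `EReal` (so it may be `⊤ = ∞`). -/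
def detourCost {M : Type*} [MetricSpace M] (b : M) (h₁ h₂ : M → ℝ) : EReal :=
  ⨅ z : {z : ℕ → M // HoroLim b z h₁},
    Filter.liminf (fun n => ((dist b (z.1 n) + h₂ (z.1 n) : ℝ) : EReal)) Filter.atTop

/-- Detour distance `δ(h₁,h₂) = H(h₁,h₂) + H(h₂,h₁)`. -/
def detourDist {M : Type*} [MetricSpace M] (b : M) (h₁ h₂ : M → ℝ) : EReal :=
  detourCost b h₁ h₂ + detourCost b h₂ h₁

section Horofunctions

variable {M : Type*} [MetricSpace M] {b : M} {h : M → ℝ}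

namespace HoroLim

variable {y : ℕ → M}

theorem le_dist_add (hy : HoroLim b y h) (x z : M) : h x ≤ dist x z + h z := by
  refine le_of_tendsto_of_tendsto' (hy x) ((hy z).const_add (dist x z)) fun n => ?_
  have := dist_triangle x z (y n)
  simp only [horo]
  linarith

theorem apply_base (hy : HoroLim b y h) : h b = 0 :=
  tendsto_nhds_unique (hy b) (by simp [horo])

theorem neg_dist_le (hy : HoroLim b y h) (x : M) : 0 ≤ dist b x + h x := by
  have := hy.le_dist_add b x
  rwa [hy.apply_base] at this

theorem comp_strictMono (hy : HoroLim b y h) {φ : ℕ → ℕ} (hφ : StrictMono φ) :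
    HoroLim b (y ∘ φ) h :=
  fun z => (hy z).comp hφ.tendsto_atTop

end HoroLim

theorem abs_horo_sub_horo_le (b y x z : M) : |horo b y x - horo b y z| ≤ dist x z := by
  have := abs_dist_sub_le x z y
  simpa [horo] using this

theorem abs_horo_le (b y z : M) : |horo b y z| ≤ dist z b :=
  abs_dist_sub_le z b y

theorem IsHorofunction.tendsto_dist [ProperSpace M] (hh : IsHorofunction b h) {y : ℕ → M}
    (hy : HoroLim b y h) : Tendsto (fun n => dist b (y n)) atTop atTop := by
  by_contra hcon
  rw [tendsto_atTop] at hcon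
  push Not at hcon
  obtain ⟨R, hR⟩ := hcon
  have hfreq : ∃ᶠ n in atTop, y n ∈ Metric.closedBall b R := by
    refine hR.mono fun n hn => ?_
    rw [Metric.mem_closedBall, dist_comm]
    exact hn.le
  obtain ⟨a, -, φ, hφ, hlim⟩ := (isCompact_closedBall b R).tendsto_subseq' hfreq
  refine hh.2 a (funext fun z => tendsto_nhds_unique (hy.comp_strictMono hφ z) ?_)
  exact (tendsto_const_nhds.dist hlim).sub (tendsto_const_nhds.dist hlim)

/-- A limit of `h_{y^n}` with `y^n` going to infinity in a proper geodesic space attains every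
value `-r`, `r ≥ 0`. -/
theorem HoroLim.exists_eq_neg [ProperSpace M] (hgeo : IsGeodesicSpace M) {y : ℕ → M}
    (hy : HoroLim b y h) (hd : Tendsto (fun n => dist b (y n)) atTop atTop) {r : ℝ} (hr : 0 ≤ r) :
    ∃ w, h w = -r := by
  have hex : ∀ n, ∃ w, dist b w ≤ r ∧ (r ≤ dist b (y n) → horo b (y n) w = -r) := by
    intro n
    by_cases hn : r ≤ dist b (y n)
    · obtain ⟨γ, h0, h1, hγ⟩ := hgeo b (y n)
      have hb := hγ 0 ⟨le_rfl, dist_nonneg⟩ r ⟨hr, hn⟩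
      have he := hγ r ⟨hr, hn⟩ _ ⟨dist_nonneg, le_rfl⟩
      rw [h0, zero_sub, abs_neg, abs_of_nonneg hr] at hb
      rw [h1, abs_sub_comm, abs_of_nonneg (sub_nonneg.2 hn)] at he
      exact ⟨γ r, hb.le, fun _ => by rw [horo, he]; ring⟩
    · exact ⟨b, by simpa using hr, fun h' => absurd h' hn⟩
  choose w hw1 hw2 using hex
  obtain ⟨a, -, φ, hφ, hlim⟩ := (isCompact_closedBall b r).tendsto_subseq (x := w)
    (fun n => by rw [Metric.mem_closedBall, dist_comm]; exact hw1 n)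
  refine ⟨a, tendsto_nhds_unique (hy.comp_strictMono hφ a) ?_⟩
  rw [tendsto_iff_dist_tendsto_zero]
  refine squeeze_zero' (Eventually.of_forall fun _ => dist_nonneg) ?_
    (tendsto_iff_dist_tendsto_zero.1 hlim)
  filter_upwards [(hd.comp hφ.tendsto_atTop).eventually_ge_atTop r] with n hn
  have := abs_horo_sub_horo_le b (y (φ n)) a (w (φ n))
  rw [hw2 _ hn] at this
  rw [Real.dist_eq, Function.comp_apply, Function.comp_apply, dist_comm]
  exact this

theorem ne_horo_of_forall_exists_le (hunb : ∀ c, ∃ w, h w ≤ c) (y : M) : h ≠ horo b y := by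
  rintro rfl
  obtain ⟨w, hw⟩ := hunb (-dist b y - 1)
  have : 0 ≤ dist w y := dist_nonneg
  simp only [horo] at hw
  linarith

theorem IsHorofunction.exists_le [ProperSpace M] (hgeo : IsGeodesicSpace M)
    (hh : IsHorofunction b h) (c : ℝ) : ∃ w, h w ≤ c := by
  obtain ⟨y, hy⟩ := hh.1
  obtain ⟨w, hw⟩ := hy.exists_eq_neg hgeo (hh.tendsto_dist hy) (abs_nonneg c)
  exact ⟨w, hw.trans_le (neg_abs_le c)⟩

/-- The sequence `z` converges to `h` and realizes the vanishing of the detour cost `H(h,h)`. -/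
structure IsOptimalSeq (b : M) (h : M → ℝ) (z : ℕ → M) : Prop where
  horoLim : HoroLim b z h
  tendsto_dist : Tendsto (fun n => dist b (z n)) atTop atTop
  tendsto_zero : Tendsto (fun n => dist b (z n) + h (z n)) atTop (𝓝 0)

theorem IsAlmostGeodesicSeq.isOptimalSeq {y : ℕ → M} (hy : IsAlmostGeodesicSeq y)
    (hlim : HoroLim b y h) : IsOptimalSeq b h y := by
  refine ⟨hlim, ?_, ?_⟩
  · refine tendsto_atTop_mono (fun n => ?_) (tendsto_atTop_add_const_right _ (-dist b (y 0)) hy.1)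
    have := dist_triangle (y n) b (y 0)
    rw [dist_comm (y n) b] at this
    linarith
  · have hsmall : Tendsto (fun k => h (y k) - h (y 0) + dist (y k) (y 0)) atTop (𝓝 0) := by
      rw [Metric.tendsto_atTop]
      intro ε hε
      obtain ⟨K, hK⟩ := hy.2 (ε / 2) (half_pos hε)
      refine ⟨K, fun k hk => ?_⟩
      have hle : h (y k) - h (y 0) + dist (y k) (y 0) ≤ ε / 2 := by
        refine le_of_tendsto (((hlim (y k)).sub (hlim (y 0))).add_const (dist (y k) (y 0))) ?_
        filter_upwards [eventually_ge_atTop k] with m hm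
        have := hK m k hk hm
        simp only [horo]
        rw [dist_comm (y k) (y m), dist_comm (y 0) (y m)]
        linarith
      have hge := hlim.le_dist_add (y 0) (y k)
      rw [dist_comm] at hge
      rw [Real.dist_eq, sub_zero, abs_of_nonneg (by linarith)]
      linarith
    have := (hsmall.sub (hlim (y 0))).add_const (h (y 0))
    rw [sub_eq_add_neg, zero_add, neg_add_cancel] at this
    refine this.congr fun k => ?_
    rw [horo, dist_comm (y 0) (y k)]
    ring

theorem IsOptimalSeq.comp_strictMono {z : ℕ → M} (hz : IsOptimalSeq b h z) {φ : ℕ → ℕ}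
    (hφ : StrictMono φ) : IsOptimalSeq b h (z ∘ φ) :=
  ⟨hz.1.comp_strictMono hφ, hz.2.comp hφ.tendsto_atTop, hz.3.comp hφ.tendsto_atTop⟩

theorem exists_strictMono_forall_lt {P : ℕ → ℕ → Prop} (hP : ∀ n, ∀ᶠ m in atTop, P n m) :
    ∃ φ : ℕ → ℕ, StrictMono φ ∧ ∀ k m, k < m → P (φ k) (φ m) := by
  choose K hK using fun n => eventually_atTop.1 (hP n)
  let φ : ℕ → ℕ := fun k => Nat.rec 0 (fun _ n => max (n + 1) (K n)) k
  have hstep : ∀ k, φ (k + 1) = max (φ k + 1) (K (φ k)) := fun k => rfl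
  have hφ : StrictMono φ := strictMono_nat_of_lt_succ fun k => by rw [hstep]; omega
  refine ⟨φ, hφ, fun k m hkm => hK _ _ ?_⟩
  have := hφ.monotone (Nat.succ_le_of_lt hkm)
  rw [Nat.succ_eq_add_one, hstep] at this
  omega

theorem IsOptimalSeq.isBusemannPoint {z : ℕ → M} (hz : IsOptimalSeq b h z) :
    IsBusemannPoint b h := by
  refine ⟨⟨⟨z, hz.1⟩, ne_horo_of_forall_exists_le fun c => ?_⟩, ?_⟩
  · obtain ⟨n, hn, hn'⟩ := ((hz.2.eventually_ge_atTop (1 - c)).and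
      (hz.3.eventually_le_const one_pos)).exists
    exact ⟨z n, by linarith⟩
  have hP : ∀ n, ∀ᶠ m in atTop, horo b (z m) (z n) < h (z n) + 1 / ((n : ℝ) + 1) := fun n =>
    (hz.1 (z n)).eventually_lt_const (lt_add_of_pos_right _ Nat.one_div_pos_of_nat)
  obtain ⟨φ, hφ, hφP⟩ := exists_strictMono_forall_lt hP
  have hzφ := hz.comp_strictMono hφ
  refine ⟨z ∘ φ, ⟨?_, fun ε hε => ?_⟩, hzφ.1⟩
  · refine tendsto_atTop_mono (fun n => ?_)
      (tendsto_atTop_add_const_right _ (-dist b ((z ∘ φ) 0)) hzφ.2)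
    have := dist_triangle_right b ((z ∘ φ) n) ((z ∘ φ) 0)
    have := dist_triangle b ((z ∘ φ) 0) ((z ∘ φ) n)
    rw [dist_comm ((z ∘ φ) 0)] at this
    linarith
  · have herr : Tendsto (fun k => dist b (z (φ k)) + h (z (φ k)) + 1 / ((φ k : ℝ) + 1)) atTop
        (𝓝 0) := by
      simpa using hzφ.3.add (tendsto_one_div_add_atTop_nhds_zero_nat.comp hφ.tendsto_atTop)
    obtain ⟨K₁, hK₁⟩ := eventually_atTop.1 (herr.eventually_lt_const (half_pos hε))
    obtain ⟨K₂, hK₂⟩ := Metric.cauchySeq_iff.1 (hzφ.1 (z (φ 0))).cauchySeq (ε / 2) (half_pos hε)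
    refine ⟨max K₁ K₂, fun m k hk hkm => ?_⟩
    rcases hkm.eq_or_lt with rfl | hlt
    · simpa using hε
    · have h₁ := hK₁ k (le_of_max_le_left hk)
      have h₂ := (abs_lt.1 (hK₂ k (le_of_max_le_right hk) m
        ((le_of_max_le_right hk).trans hkm))).2
      have h₃ := hφP k m hlt
      simp only [horo, Function.comp_apply] at h₂ h₃ ⊢
      rw [dist_comm (z (φ m)) (z (φ k)), dist_comm (z (φ k)) (z (φ 0)),
        dist_comm (z (φ m)) (z (φ 0))]
      linarith

theorem isBusemannPoint_iff : IsBusemannPoint b h ↔ ∃ z, IsOptimalSeq b h z :=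
  ⟨fun ⟨_, y, hy, hlim⟩ => ⟨y, hy.isOptimalSeq hlim⟩, fun ⟨_, hz⟩ => hz.isBusemannPoint⟩

/-- In a geodesic space a point may be chosen between `x` and `y` at any distance from `b` lying
between those of `x` and of `y`. -/
theorem IsGeodesicSpace.exists_between (hgeo : IsGeodesicSpace M) (b x y : M) {t : ℝ}
    (hx : dist b x ≤ t) (hy : t ≤ dist b y) :
    ∃ w, dist b w = t ∧ dist x w + dist w y = dist x y := by
  obtain ⟨γ, h0, h1, hγ⟩ := hgeo x y
  have hcont : ContinuousOn γ (Set.Icc 0 (dist x y)) := by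
    refine (LipschitzOnWith.of_dist_le_mul (K := 1) fun s hs t ht => ?_).continuousOn
    rw [hγ s hs t ht, NNReal.coe_one, one_mul, Real.dist_eq]
  obtain ⟨s, hs, hst⟩ := intermediate_value_Icc (f := fun s => dist b (γ s)) dist_nonneg
    (fun s hs => tendsto_const_nhds.dist (hcont s hs))
    (show t ∈ Set.Icc (dist b (γ 0)) (dist b (γ (dist x y))) by rw [h0, h1]; exact ⟨hx, hy⟩)
  refine ⟨γ s, hst, ?_⟩
  have hl := hγ 0 ⟨le_rfl, dist_nonneg⟩ s hs
  have hr := hγ s hs _ ⟨dist_nonneg, le_rfl⟩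
  rw [h0, zero_sub, abs_neg, abs_of_nonneg hs.1] at hl
  rw [h1, abs_sub_comm, abs_of_nonneg (sub_nonneg.2 hs.2)] at hr
  rw [hl, hr]
  ring

theorem exists_last_le {r : ℕ → ℝ} (hr : Tendsto r atTop atTop) {t : ℝ} (ht : r 0 ≤ t) :
    ∃ k, r k ≤ t ∧ ∀ m, k < m → t < r m := by
  obtain ⟨K, hK⟩ := eventually_atTop.1 (hr.eventually_gt_atTop t)
  refine ⟨Nat.findGreatest (fun k => r k ≤ t) K,
    Nat.findGreatest_spec (P := fun k => r k ≤ t) K.zero_le ht, fun m hm => ?_⟩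
  by_cases hmK : m ≤ K
  · exact not_le.1 (Nat.findGreatest_is_greatest hm hmK)
  · exact hK m (not_le.1 hmK).le

theorem IsBusemannPoint.exists_ray (hgeo : IsGeodesicSpace M) (hh : IsBusemannPoint b h) :
    ∃ w : ℝ → M, (∀ᶠ t in atTop, dist b (w t) = t) ∧
      (∀ x, Tendsto (fun t => horo b (w t) x) atTop (𝓝 (h x))) ∧
      Tendsto (fun t => dist b (w t) + h (w t)) atTop (𝓝 0) := by
  obtain ⟨-, y, hy, hlim⟩ := hh
  obtain ⟨-, hd, he⟩ := hy.isOptimalSeq hlim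
  set r : ℕ → ℝ := fun n => dist b (y n) with hr
  set Δ : ℕ → ℝ := fun k => dist (y k) (y (k + 1)) + r k - r (k + 1) with hΔ
  have hΔlim : Tendsto Δ atTop (𝓝 0) := by
    have hgap : Tendsto (fun k => dist (y (k + 1)) (y k) + dist (y k) (y 0) - dist (y (k + 1)) (y 0))
        atTop (𝓝 0) := by
      rw [Metric.tendsto_atTop]
      intro ε hε
      obtain ⟨K, hK⟩ := hy.2 ε hε
      refine ⟨K, fun k hk => ?_⟩
      rw [Real.dist_eq, sub_zero,
        abs_of_nonneg (by linarith [dist_triangle (y (k + 1)) (y k) (y 0)])]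
      exact hK _ _ hk k.le_succ
    have hb := hlim (y 0)
    have := (hgap.sub hb).add (hb.comp (tendsto_add_atTop_nat 1))
    rw [zero_sub, neg_add_cancel] at this
    refine this.congr fun k => ?_
    simp only [horo, Function.comp_apply, hΔ, hr]
    rw [dist_comm (y (k + 1)) (y k), dist_comm (y (k + 1)) (y 0), dist_comm (y k) (y 0)]
    ring
  have hex : ∀ t, ∃ k w, r 0 ≤ t → (∀ m, r m ≤ t → m ≤ k) ∧ dist b w = t ∧
      dist (y k) w + dist w (y (k + 1)) = dist (y k) (y (k + 1)) := by
    intro t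
    by_cases ht : r 0 ≤ t
    · obtain ⟨k, hk, hk'⟩ := exists_last_le hd ht
      obtain ⟨w, hw, hw'⟩ := hgeo.exists_between b (y k) (y (k + 1)) hk (hk' _ k.lt_succ_self).le
      exact ⟨k, w, fun _ => ⟨fun m hm => not_lt.1 fun hlt => (hk' m hlt).not_ge hm, hw, hw'⟩⟩
    · exact ⟨0, b, fun h' => absurd h' ht⟩
  choose k w hkw using hex
  have hk : Tendsto k atTop atTop := by
    rw [tendsto_atTop]
    intro K
    filter_upwards [eventually_ge_atTop (r 0), eventually_ge_atTop (r K)] with t h0 hK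
    exact (hkw t h0).1 K hK
  have hk1 : Tendsto (fun t => k t + 1) atTop atTop := (tendsto_add_atTop_nat 1).comp hk
  refine ⟨w, ?_, fun x => ?_, ?_⟩
  · filter_upwards [eventually_ge_atTop (r 0)] with t h0 using (hkw t h0).2.1
  · have hup := ((hlim x).comp hk).add (hΔlim.comp hk)
    have hlow := ((hlim x).comp hk1).sub (hΔlim.comp hk)
    rw [add_zero] at hup
    rw [sub_zero] at hlow
    refine tendsto_of_tendsto_of_tendsto_of_le_of_le' hlow hup ?_ ?_
    all_goals
      filter_upwards [eventually_ge_atTop (r 0)] with t h0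
      obtain ⟨-, hw, hw'⟩ := hkw t h0
      simp only [horo, Function.comp_apply, hΔ, hr]
      have h₁ := dist_triangle x (w t) (y (k t + 1))
      have h₂ := dist_triangle x (y (k t)) (w t)
      have h₃ := dist_triangle b (y (k t)) (w t)
      have h₄ := dist_triangle b (w t) (y (k t + 1))
      linarith
  · have hup := (he.comp hk1).add (hΔlim.comp hk)
    rw [add_zero] at hup
    refine squeeze_zero' (Eventually.of_forall fun t => hlim.neg_dist_le (w t)) ?_ hup
    filter_upwards [eventually_ge_atTop (r 0)] with t h0
    obtain ⟨-, hw, hw'⟩ := hkw t h0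
    simp only [Function.comp_apply, hΔ, hr]
    have h₁ := hlim.le_dist_add (w t) (y (k t + 1))
    have h₂ := dist_triangle b (y (k t)) (w t)
    linarith

end Horofunctions

section DetourCost

variable {M : Type*} [MetricSpace M] {b : M} {h₁ h₂ : M → ℝ}

theorem sub_le_detourCost {y : ℕ → M} (hy : HoroLim b y h₂) (x : M) :
    ((h₂ x - h₁ x : ℝ) : EReal) ≤ detourCost b h₁ h₂ := by
  refine le_iInf fun ⟨z, hz⟩ => ?_
  have ht : Tendsto (fun n => ((h₂ x - horo b (z n) x : ℝ) : EReal)) atTop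
      (𝓝 ((h₂ x - h₁ x : ℝ) : EReal)) :=
    (continuous_coe_real_ereal.tendsto _).comp ((hz x).const_sub (h₂ x))
  rw [← ht.liminf_eq]
  refine liminf_le_liminf (Eventually.of_forall fun n => EReal.coe_le_coe_iff.2 ?_)
  have := hy.le_dist_add x (z n)
  simp only [horo]
  linarith

theorem detourCost_nonneg {y₁ y₂ : ℕ → M} (hy₁ : HoroLim b y₁ h₁) (hy₂ : HoroLim b y₂ h₂) :
    0 ≤ detourCost b h₁ h₂ := by
  simpa [hy₁.apply_base, hy₂.apply_base] using sub_le_detourCost (h₁ := h₁) hy₂ b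

theorem detourCost_le {z : ℕ → M} (hz : HoroLim b z h₁) {u : ℕ → ℝ} {c : ℝ}
    (hu : Tendsto u atTop (𝓝 c)) (hle : ∀ᶠ n in atTop, dist b (z n) + h₂ (z n) ≤ u n) :
    detourCost b h₁ h₂ ≤ c := by
  refine iInf_le_of_le ⟨z, hz⟩ ?_
  have ht : Tendsto (fun n => (u n : EReal)) atTop (𝓝 (c : EReal)) :=
    (continuous_coe_real_ereal.tendsto _).comp hu
  rw [← ht.liminf_eq]
  exact liminf_le_liminf (hle.mono fun n hn => EReal.coe_le_coe_iff.2 hn)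

theorem detourCost_lt_top_of_le_add {z : ℕ → M} (hz : IsOptimalSeq b h₁ z) {C : ℝ}
    (hC : ∀ x, h₂ x ≤ h₁ x + C) : detourCost b h₁ h₂ < ⊤ := by
  refine (detourCost_le hz.1 (hz.3.add_const C) (Eventually.of_forall fun n => ?_)).trans_lt
    (EReal.coe_lt_top _)
  linarith [hC (z n)]

theorem exists_le_add_of_detourCost_lt_top {y : ℕ → M} (hy : HoroLim b y h₂)
    (hlt : detourCost b h₁ h₂ < ⊤) : ∃ C : ℝ, ∀ x, h₂ x ≤ h₁ x + C := by
  obtain ⟨C, hC, -⟩ := EReal.lt_iff_exists_real_btwn.1 hlt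
  refine ⟨C, fun x => ?_⟩
  have := EReal.coe_lt_coe_iff.1 ((sub_le_detourCost (h₁ := h₁) hy x).trans_lt hC)
  linarith

theorem detourDist_lt_top_iff {y₁ y₂ : ℕ → M} (hy₁ : HoroLim b y₁ h₁) (hy₂ : HoroLim b y₂ h₂) :
    detourDist b h₁ h₂ < ⊤ ↔ detourCost b h₁ h₂ < ⊤ ∧ detourCost b h₂ h₁ < ⊤ := by
  have h₀ := (EReal.bot_lt_zero.trans_le (detourCost_nonneg hy₁ hy₂)).ne'
  have h₀' := (EReal.bot_lt_zero.trans_le (detourCost_nonneg hy₂ hy₁)).ne'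
  refine ⟨fun hlt => ⟨lt_top_iff_ne_top.2 fun he => ?_, lt_top_iff_ne_top.2 fun he => ?_⟩,
    fun hlt => EReal.add_lt_top hlt.1.ne hlt.2.ne⟩
  · rw [detourDist, he, EReal.top_add_of_ne_bot h₀'] at hlt
    exact hlt.ne rfl
  · rw [detourDist, he, EReal.add_top_of_ne_bot h₀] at hlt
    exact hlt.ne rfl

end DetourCost

theorem exists_horoLim_of_denseRange {M ι : Type*} [MetricSpace M] {b : M} {s : ι → M}
    (hs : DenseRange s) {y : ℕ → M}
    (hconv : ∀ i, ∃ l, Tendsto (fun n => horo b (y n) (s i)) atTop (𝓝 l)) :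
    ∃ h, HoroLim b y h := by
  suffices hex : ∀ z, ∃ l, Tendsto (fun n => horo b (y n) z) atTop (𝓝 l) by
    choose h hh using hex
    exact ⟨h, hh⟩
  refine fun z => cauchySeq_tendsto_of_complete (Metric.cauchySeq_iff.2 fun ε hε => ?_)
  obtain ⟨i, hi⟩ := hs.exists_dist_lt z (show 0 < ε / 3 by positivity)
  obtain ⟨l, hl⟩ := hconv i
  obtain ⟨K, hK⟩ := Metric.cauchySeq_iff.1 hl.cauchySeq (ε / 3) (by positivity)
  refine ⟨K, fun m hm n hn => ?_⟩
  have h₁ := abs_le.1 (abs_horo_sub_horo_le b (y m) z (s i))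
  have h₂ := abs_le.1 (abs_horo_sub_horo_le b (y n) z (s i))
  have h₃ := abs_lt.1 (hK m hm n hn)
  exact abs_lt.2 ⟨by linarith [h₁.1, h₂.2, h₃.1], by linarith [h₁.2, h₂.1, h₃.2]⟩

section Product

variable {ι : Type*} {N : ι → Type*}

/-- The function `x ↦ max_{j ∈ J} (f_j(x_j) - β_j)` on the product. -/
def maxHoro (J : Finset ι) (hJ : J.Nonempty) (f : ∀ j, N j → ℝ) (β : ι → ℝ)
    (x : ∀ j, N j) : ℝ :=
  J.sup' hJ fun j => f j (x j) - β j

variable {J J' : Finset ι} {hJ : J.Nonempty} {hJ' : J'.Nonempty} {f f' : ∀ j, N j → ℝ}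
  {β β' : ι → ℝ}

theorem le_maxHoro {j : ι} (hj : j ∈ J) (x : ∀ j, N j) : f j (x j) - β j ≤ maxHoro J hJ f β x :=
  Finset.le_sup' (fun j => f j (x j) - β j) hj

theorem exists_forall_apply_le (b : ∀ j, N j) (hunb : ∀ j ∈ J, ∀ c, ∃ w, f j w ≤ c) (j₀ : ι)
    (x₀ : N j₀) (c : ι → ℝ) :
    ∃ x : ∀ j, N j, x j₀ = x₀ ∧ ∀ j ∈ J, j ≠ j₀ → f j (x j) ≤ c j := by
  classical
  have hex : ∀ j, ∃ w, j ∈ J → f j w ≤ c j := fun j => by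
    by_cases hj : j ∈ J
    · exact (hunb j hj (c j)).imp fun _ hw _ => hw
    · exact ⟨b j, fun h => absurd h hj⟩
  choose w hw using hex
  refine ⟨Function.update w j₀ x₀, Function.update_self .., fun j hj hne => ?_⟩
  rw [Function.update_of_ne hne]
  exact hw j hj

theorem exists_maxHoro_eq (b : ∀ j, N j) (hunb : ∀ j ∈ J, ∀ c, ∃ w, f j w ≤ c) {j₀ : ι}
    (hj₀ : j₀ ∈ J) (x₀ : N j₀) :
    ∃ x : ∀ j, N j, x j₀ = x₀ ∧ maxHoro J hJ f β x = f j₀ x₀ - β j₀ := by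
  obtain ⟨x, rfl, hx⟩ := exists_forall_apply_le b hunb j₀ x₀ fun j => f j₀ x₀ - β j₀ + β j
  refine ⟨x, rfl, le_antisymm (Finset.sup'_le _ _ fun j hj => ?_) (le_maxHoro hj₀ x)⟩
  rcases eq_or_ne j j₀ with rfl | hne
  · exact le_rfl
  · linarith [hx j hj hne]

theorem exists_maxHoro_le (b : ∀ j, N j) (hunb : ∀ j ∈ J, ∀ c, ∃ w, f j w ≤ c) {j₀ : ι}
    (hj₀ : j₀ ∉ J) (x₀ : N j₀) (c : ℝ) :
    ∃ x : ∀ j, N j, x j₀ = x₀ ∧ maxHoro J hJ f β x ≤ c := by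
  obtain ⟨x, hx₀, hx⟩ := exists_forall_apply_le b hunb j₀ x₀ fun j => c + β j
  refine ⟨x, hx₀, Finset.sup'_le _ _ fun j hj => ?_⟩
  linarith [hx j hj fun h => hj₀ (h ▸ hj)]

theorem subset_of_maxHoro_le_add (b : ∀ j, N j) (hunb : ∀ j ∈ J, ∀ c, ∃ w, f j w ≤ c) {C : ℝ}
    (hC : ∀ x, maxHoro J' hJ' f' β' x ≤ maxHoro J hJ f β x + C) : J' ⊆ J := by
  intro j hj
  by_contra hjJ
  obtain ⟨x, hxj, hx⟩ := exists_maxHoro_le (hJ := hJ) (β := β) b hunb hjJ (b j)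
    (f' j (b j) - β' j - C - 1)
  have := le_maxHoro (hJ := hJ') (f := f') (β := β') hj x
  rw [hxj] at this
  linarith [hC x]

theorem le_add_of_maxHoro_le_add (b : ∀ j, N j) (hunb : ∀ j ∈ J, ∀ c, ∃ w, f j w ≤ c) {C : ℝ}
    (hC : ∀ x, maxHoro J' hJ' f' β' x ≤ maxHoro J hJ f β x + C) {j : ι} (hj : j ∈ J)
    (hj' : j ∈ J') (w : N j) : f' j w ≤ f j w + (C + β' j - β j) := by
  obtain ⟨x, rfl, hx⟩ := exists_maxHoro_eq (hJ := hJ) (β := β) b hunb hj w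
  have := le_maxHoro (hJ := hJ') (f := f') (β := β') hj' x
  linarith [hC x]

theorem le_of_maxHoro_eq (b : ∀ j, N j) (hunb : ∀ j ∈ J, ∀ c, ∃ w, f j w ≤ c)
    (heq : maxHoro J hJ f β = maxHoro J hJ f β') {j : ι} (hj : j ∈ J) : β j ≤ β' j := by
  have := le_add_of_maxHoro_le_add (β' := β') (C := 0) b hunb (fun x => by rw [heq, add_zero]) hj hj (b j)
  linarith

variable [∀ j, MetricSpace (N j)] [Fintype ι]

theorem exists_common_subseq [∀ j, ProperSpace (N j)] (b : ∀ j, N j) (y : ℕ → ∀ j, N j) :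
    ∃ φ : ℕ → ℕ, StrictMono φ ∧ ∃ f : ∀ j, N j → ℝ,
      ∀ j, HoroLim (b j) (fun n => y (φ n) j) (f j) := by
  have : ∀ j, Nonempty (N j) := fun j => ⟨b j⟩
  let s : ∀ j, ℕ → N j := fun j => TopologicalSpace.denseSeq (N j)
  let F : ℕ → ι × ℕ → ℝ := fun n p => horo (b p.1) (y n p.1) (s p.1 p.2)
  have hK : IsCompact (Set.univ.pi fun p : ι × ℕ =>
      Set.Icc (-dist (s p.1 p.2) (b p.1)) (dist (s p.1 p.2) (b p.1))) :=
    isCompact_univ_pi fun p => isCompact_Icc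
  obtain ⟨l, -, φ, hφ, hl⟩ := hK.tendsto_subseq (x := F)
    fun n p _ => abs_le.1 (abs_horo_le (b p.1) (y n p.1) (s p.1 p.2))
  rw [tendsto_pi_nhds] at hl
  choose f hf using fun j => exists_horoLim_of_denseRange (b := b j) (y := fun n => y (φ n) j)
    (TopologicalSpace.denseRange_denseSeq (N j)) fun i => ⟨l (j, i), hl (j, i)⟩
  exact ⟨φ, hφ, f, hf⟩

theorem horoLim_maxHoro {b : ∀ j, N j} {y : ℕ → ∀ j, N j}
    (hd : Tendsto (fun n => dist b (y n)) atTop atTop)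
    (hf : ∀ j ∈ J, HoroLim (b j) (fun n => y n j) (f j))
    (hβ : ∀ j ∈ J, Tendsto (fun n => dist b (y n) - dist (b j) (y n j)) atTop (𝓝 (β j)))
    (hnot : ∀ j ∉ J, Tendsto (fun n => dist b (y n) - dist (b j) (y n j)) atTop atTop) :
    HoroLim b y (maxHoro J hJ f β) := by
  intro z
  have hlim : ∀ j ∈ J, Tendsto (fun n => dist (z j) (y n j) - dist b (y n)) atTop
      (𝓝 (f j (z j) - β j)) := fun j hj =>
    ((hf j hj (z j)).sub (hβ j hj)).congr fun n => by rw [horo]; ring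
  refine tendsto_order.2 ⟨fun a ha => ?_, fun a ha => ?_⟩
  · obtain ⟨j, hj, hja⟩ := (Finset.lt_sup'_iff hJ).1 ha
    filter_upwards [(hlim j hj).eventually_const_lt hja] with n hn
    exact hn.trans_le (sub_le_sub_right (dist_le_pi_dist z (y n) j) _)
  · obtain ⟨c, hc, hca⟩ := exists_between ha
    have hall : ∀ j, ∀ᶠ n in atTop, dist (z j) (y n j) - dist b (y n) < c := by
      intro j
      by_cases hj : j ∈ J
      · exact (hlim j hj).eventually_lt_const ((le_maxHoro hj z).trans_lt hc)
      · filter_upwards [(hnot j hj).eventually_gt_atTop (dist (z j) (b j) - c)] with n hn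
        linarith [dist_triangle (z j) (b j) (y n j)]
    filter_upwards [eventually_all.2 hall, hd.eventually_ge_atTop (-c)] with n hn hn'
    have hle : dist z (y n) ≤ c + dist b (y n) :=
      (dist_pi_le_iff (by linarith)).2 fun j => by linarith [hn j]
    rw [horo]
    linarith

theorem exists_dist_eq_pi_dist {x y : ∀ j, N j} (hxy : 0 < dist x y) :
    ∃ j, dist (x j) (y j) = dist x y := by
  by_contra! hne
  exact lt_irrefl _ ((dist_pi_lt_iff hxy).2 fun j => (dist_le_pi_dist x y j).lt_of_ne (hne j))

/-- The normalized parameters `β ∈ ℝ^J` with `min_{j ∈ J} β_j = 0`, extended by `0` outside `J`. -/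
def minZeroSet (J : Finset ι) : Set (ι → ℝ) :=
  {β | (∀ i ∉ J, β i = 0) ∧ (∀ j ∈ J, 0 ≤ β j) ∧ ∃ j ∈ J, β j = 0}

theorem IsHorofunction.exists_eq_maxHoro [∀ j, ProperSpace (N j)]
    (hgeo : ∀ j, IsGeodesicSpace (N j)) {b : ∀ j, N j} {h : (∀ j, N j) → ℝ}
    (hh : IsHorofunction b h) :
    ∃ (J : Finset ι) (hJ : J.Nonempty) (f : ∀ j, N j → ℝ), ∃ β ∈ minZeroSet J,
      (∀ j ∈ J, IsHorofunction (b j) (f j)) ∧ h = maxHoro J hJ f β := by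
  classical
  obtain ⟨y₀, hy₀⟩ := hh.1
  obtain ⟨φ₁, hφ₁, f, hf₁⟩ := exists_common_subseq b y₀
  obtain ⟨a, φ₂, hφ₂, ha⟩ := CompactSpace.tendsto_subseq fun n => fun j =>
    ENNReal.ofReal (dist b (y₀ (φ₁ n)) - dist (b j) (y₀ (φ₁ n) j))
  rw [tendsto_pi_nhds] at ha
  set y := y₀ ∘ φ₁ ∘ φ₂ with hydef
  have hy : HoroLim b y h := hy₀.comp_strictMono (hφ₁.comp hφ₂)
  have hd := hh.tendsto_dist hy
  have hf : ∀ j, HoroLim (b j) (fun n => y n j) (f j) := fun j => (hf₁ j).comp_strictMono hφ₂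
  have hnn : ∀ n j, 0 ≤ dist b (y n) - dist (b j) (y n j) := fun n j =>
    sub_nonneg.2 (dist_le_pi_dist b (y n) j)
  replace ha : ∀ j, Tendsto (fun n => ENNReal.ofReal (dist b (y n) - dist (b j) (y n j))) atTop
    (𝓝 (a j)) := ha
  have hfin : ∀ j, a j ≠ ⊤ → Tendsto (fun n => dist b (y n) - dist (b j) (y n j)) atTop
      (𝓝 (a j).toReal) := fun j hj =>
    ((ENNReal.tendsto_toReal hj).comp (ha j)).congr fun n => ENNReal.toReal_ofReal (hnn n j)
  have hinf : ∀ j, a j = ⊤ → Tendsto (fun n => dist b (y n) - dist (b j) (y n j)) atTop atTop :=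
    fun j hj => ENNReal.tendsto_ofReal_nhds_top.1 (hj ▸ ha j)
  have hzero : ∃ j, a j = 0 := by
    by_contra! hne
    have hpos : ∀ᶠ n in atTop, ∀ j,
        0 < ENNReal.ofReal (dist b (y n) - dist (b j) (y n j)) :=
      eventually_all.2 fun j => (ha j).eventually_const_lt (pos_iff_ne_zero.2 (hne j))
    obtain ⟨n, hn, hn'⟩ := (hpos.and (hd.eventually_gt_atTop 0)).exists
    obtain ⟨j, hj⟩ := exists_dist_eq_pi_dist hn'
    simpa [hj] using hn j
  obtain ⟨j₀, hj₀⟩ := hzero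
  have hmem : ∀ j, j ∈ Finset.univ.filter (fun j => a j ≠ ⊤) ↔ a j ≠ ⊤ := by simp
  have hj₀J : j₀ ∈ Finset.univ.filter (fun j => a j ≠ ⊤) := by simp [hj₀]
  refine ⟨Finset.univ.filter fun j => a j ≠ ⊤, ⟨j₀, hj₀J⟩, f, fun j => (a j).toReal,
    ⟨fun i hi => ?_, fun _ _ => ENNReal.toReal_nonneg, j₀, hj₀J, by simp [hj₀]⟩,
    fun j hj => ⟨⟨_, hf j⟩, ne_horo_of_forall_exists_le fun c => ?_⟩, ?_⟩
  · rw [hmem, not_not] at hi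
    simp [hi]
  · have hdj : Tendsto (fun n => dist (b j) (y n j)) atTop atTop := by
      refine (hd.atTop_add (hfin j ((hmem j).1 hj)).neg).congr fun n => ?_
      ring
    obtain ⟨w, hw⟩ := (hf j).exists_eq_neg (hgeo j) hdj (abs_nonneg c)
    exact ⟨w, hw.trans_le (neg_abs_le c)⟩
  · refine funext fun z => tendsto_nhds_unique (hy z) (horoLim_maxHoro hd (fun j _ => hf j)
      (fun j hj => hfin j ((hmem j).1 hj)) (fun j hj => hinf j ?_) z)
    rwa [hmem, not_not] at hj

/-- A sequence witnessing that `maxHoro J hJ f β` is a Busemann point, together with the values of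
`dist b ·` and the coordinatewise detour costs along it. -/
theorem exists_seq_maxHoro (hgeo : ∀ j, IsGeodesicSpace (N j)) {b : ∀ j, N j}
    (hf : ∀ j ∈ J, IsBusemannPoint (b j) (f j)) (hJ : J.Nonempty) (hβ : β ∈ minZeroSet J) :
    ∃ z : ℕ → ∀ j, N j, HoroLim b z (maxHoro J hJ f β) ∧
      (∀ᶠ n : ℕ in atTop, dist b (z n) = n) ∧
      ∀ j ∈ J, Tendsto (fun n : ℕ => n + f j (z n j)) atTop (𝓝 (β j)) := by
  classical
  have hex : ∀ j, ∃ w : ℝ → N j, j ∈ J → (∀ᶠ t in atTop, dist (b j) (w t) = t) ∧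
      (∀ x, Tendsto (fun t => horo (b j) (w t) x) atTop (𝓝 (f j x))) ∧
      Tendsto (fun t => dist (b j) (w t) + f j (w t)) atTop (𝓝 0) := fun j => by
    by_cases hj : j ∈ J
    · exact ((hf j hj).exists_ray (hgeo j)).imp fun _ hw _ => hw
    · exact ⟨fun _ => b j, fun h => absurd h hj⟩
  choose w hw using hex
  obtain ⟨-, hβ0, j₀, hj₀, hβj₀⟩ := hβ
  have htime : ∀ j, Tendsto (fun n : ℕ => (n : ℝ) - β j) atTop atTop := fun j =>
    tendsto_atTop_add_const_right _ (-β j) tendsto_natCast_atTop_atTop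
  let z : ℕ → ∀ j, N j := fun n j => if j ∈ J then w j (n - β j) else b j
  have hzJ : ∀ j ∈ J, ∀ n, z n j = w j (n - β j) := fun j hj n => if_pos hj
  have hzJ' : ∀ j ∉ J, ∀ n, z n j = b j := fun j hj n => if_neg hj
  have hdj : ∀ j ∈ J, ∀ᶠ n : ℕ in atTop, dist (b j) (z n j) = n - β j := fun j hj =>
    ((htime j).eventually (hw j hj).1).mono fun n hn => by rw [hzJ j hj, hn]
  have hd : ∀ᶠ n : ℕ in atTop, dist b (z n) = n := by
    filter_upwards [(eventually_all_finset J).2 hdj] with n hn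
    refine le_antisymm ((dist_pi_le_iff n.cast_nonneg).2 fun j => ?_) ?_
    · by_cases hj : j ∈ J
      · linarith [hn j hj, hβ0 j hj]
      · simp [hzJ' j hj]
    · simpa [hn j₀ hj₀, hβj₀] using dist_le_pi_dist b (z n) j₀
  refine ⟨z, horoLim_maxHoro ?_ (fun j hj x => ?_) (fun j hj => ?_) (fun j hj => ?_), hd,
    fun j hj => ?_⟩
  · exact tendsto_natCast_atTop_atTop.congr' (hd.mono fun n hn => hn.symm)
  · refine (((hw j hj).2.1 x).comp (htime j)).congr fun n => ?_
    simp only [Function.comp_apply, hzJ j hj]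
  · refine tendsto_const_nhds.congr' ?_
    filter_upwards [hd, hdj j hj] with n hn hn'
    rw [hn, hn']
    ring
  · refine tendsto_natCast_atTop_atTop.congr' (hd.mono fun n hn => ?_)
    simp only [hn, hzJ' j hj, dist_self, sub_zero]
  · have := (((hw j hj).2.2).comp (htime j)).add_const (β j)
    rw [zero_add] at this
    refine this.congr' ((hdj j hj).mono fun n hn => ?_)
    rw [Function.comp_apply, ← hzJ j hj, hn]
    ring

variable {b : ∀ j, N j}

theorem isBusemannPoint_maxHoro (hgeo : ∀ j, IsGeodesicSpace (N j))
    (hf : ∀ j ∈ J, IsBusemannPoint (b j) (f j)) (hβ : β ∈ minZeroSet J) :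
    IsBusemannPoint b (maxHoro J hJ f β) := by
  obtain ⟨z, hz, hd, he⟩ := exists_seq_maxHoro hgeo hf hJ hβ
  refine IsOptimalSeq.isBusemannPoint ⟨hz,
    tendsto_natCast_atTop_atTop.congr' (hd.mono fun n hn => hn.symm), ?_⟩
  have hsup := Tendsto.finset_sup'_nhds_apply hJ fun j hj => (he j hj).sub_const (β j)
  simp only [sub_self, Finset.sup'_const] at hsup
  refine hsup.congr' (hd.mono fun n hn => ?_)
  simp only [hn, maxHoro, Finset.add_sup']
  exact Finset.sup'_congr hJ rfl fun j _ => by ring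

theorem detourCost_maxHoro (hgeo : ∀ j, IsGeodesicSpace (N j))
    (hf : ∀ j ∈ J, IsBusemannPoint (b j) (f j)) (hunb : ∀ j ∈ J, ∀ c, ∃ w, f j w ≤ c)
    (hβ : β ∈ minZeroSet J) (hβ' : β' ∈ minZeroSet J) :
    detourCost b (maxHoro J hJ f β) (maxHoro J hJ f β') =
      ((J.sup' hJ fun j => β j - β' j : ℝ) : EReal) := by
  obtain ⟨z, hz, hd, he⟩ := exists_seq_maxHoro hgeo hf hJ hβ
  obtain ⟨z', hz', -⟩ := exists_seq_maxHoro hgeo hf hJ hβ'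
  refine le_antisymm ?_ ?_
  · have hsup := Tendsto.finset_sup'_nhds_apply hJ fun j hj => (he j hj).sub_const (β' j)
    refine detourCost_le hz hsup (hd.mono fun n hn => ?_)
    rw [hn, ← le_sub_iff_add_le']
    refine Finset.sup'_le _ _ fun j hj => ?_
    have := Finset.le_sup' (fun j => n + f j (z n j) - β' j) hj
    linarith
  · obtain ⟨j, hj, hjeq⟩ := J.exists_mem_eq_sup' hJ fun j => β j - β' j
    rw [hjeq]
    obtain ⟨x, hxj, hx⟩ := exists_maxHoro_eq (hJ := hJ) (β := β) b hunb hj (b j)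
    rw [← hxj] at hx
    refine le_trans (EReal.coe_le_coe_iff.2 ?_) (sub_le_detourCost hz' x)
    linarith [le_maxHoro (hJ := hJ) (f := f) (β := β') hj x]

theorem detourDist_maxHoro (hgeo : ∀ j, IsGeodesicSpace (N j))
    (hf : ∀ j ∈ J, IsBusemannPoint (b j) (f j)) (hunb : ∀ j ∈ J, ∀ c, ∃ w, f j w ≤ c)
    (hβ : β ∈ minZeroSet J) (hβ' : β' ∈ minZeroSet J) :
    detourDist b (maxHoro J hJ f β) (maxHoro J hJ f β') =
      (((J.sup' hJ fun j => β j - β' j) + (J.sup' hJ fun j => β' j - β j) : ℝ) : EReal) := by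
  rw [detourDist, detourCost_maxHoro hgeo hf hunb hβ hβ', detourCost_maxHoro hgeo hf hunb hβ' hβ,
    EReal.coe_add]

end Product

/-- each part of the horofunction boundary of the product is isometric to
(ℝ^J/Sp(1), ‖·‖_var), modelled by S = {β ∈ ℝ^J : min_{j∈J} β_j = 0} (encoded as functions on
`Fin q` vanishing outside `J`). -/
theorem stmt_13 (q : ℕ) (N : Fin q → Type*) [∀ j, MetricSpace (N j)] [∀ j, ProperSpace (N j)]
    (hgeo : ∀ j, IsGeodesicSpace (N j)) (b : ∀ j, N j)
    (hbus : ∀ j, ∀ h : N j → ℝ, IsHorofunction (b j) h → IsBusemannPoint (b j) h)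
    (hdet : ∀ j, ∀ h h' : N j → ℝ, IsBusemannPoint (b j) h → IsBusemannPoint (b j) h' →
      h ≠ h' → detourDist (b j) h h' = ⊤)
    (h : (∀ j, N j) → ℝ) (hh : IsHorofunction b h) :
    ∃ (J : Finset (Fin q)) (hJ : J.Nonempty) (ψ : (Fin q → ℝ) → ((∀ j, N j) → ℝ)),
      Set.BijOn ψ
        {β : Fin q → ℝ | (∀ i ∉ J, β i = 0) ∧ (∀ j ∈ J, 0 ≤ β j) ∧ ∃ j ∈ J, β j = 0}
        {g : (∀ j, N j) → ℝ | IsBusemannPoint b g ∧ detourDist b h g < ⊤} ∧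
      ∀ β β' : Fin q → ℝ,
        β ∈ {β : Fin q → ℝ | (∀ i ∉ J, β i = 0) ∧ (∀ j ∈ J, 0 ≤ β j) ∧ ∃ j ∈ J, β j = 0} →
        β' ∈ {β : Fin q → ℝ | (∀ i ∉ J, β i = 0) ∧ (∀ j ∈ J, 0 ≤ β j) ∧ ∃ j ∈ J, β j = 0} →
        detourDist b (ψ β) (ψ β') =
          (((J.sup' hJ fun j => β j - β' j) + (J.sup' hJ fun j => β' j - β j) : ℝ) : EReal) := by
  obtain ⟨J, hJ, f, α, hα, hf, rfl⟩ := hh.exists_eq_maxHoro hgeo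
  have hfb : ∀ j ∈ J, IsBusemannPoint (b j) (f j) := fun j hj => hbus j _ (hf j hj)
  have hunb : ∀ j ∈ J, ∀ c, ∃ w, f j w ≤ c := fun j hj => (hf j hj).exists_le (hgeo j)
  refine ⟨J, hJ, maxHoro J hJ f, ⟨fun β hβ => ⟨isBusemannPoint_maxHoro hgeo hfb hβ, ?_⟩,
    fun β hβ β' hβ' heq => ?_, fun g hg => ?_⟩,
    fun β β' hβ hβ' => detourDist_maxHoro hgeo hfb hunb hβ hβ'⟩
  · rw [detourDist_maxHoro hgeo hfb hunb hα hβ]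
    exact EReal.coe_lt_top _
  · funext j
    by_cases hj : j ∈ J
    · exact le_antisymm (le_of_maxHoro_eq b hunb heq hj) (le_of_maxHoro_eq b hunb heq.symm hj)
    · rw [hβ.1 j hj, hβ'.1 j hj]
  · obtain ⟨hgB, hδ⟩ := hg
    obtain ⟨J', hJ', f', α', hα', hf', rfl⟩ := hgB.1.exists_eq_maxHoro hgeo
    have hfb' : ∀ j ∈ J', IsBusemannPoint (b j) (f' j) := fun j hj => hbus j _ (hf' j hj)
    have hunb' : ∀ j ∈ J', ∀ c, ∃ w, f' j w ≤ c := fun j hj => (hf' j hj).exists_le (hgeo j)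
    obtain ⟨y, hy⟩ := hh.1
    obtain ⟨y', hy'⟩ := hgB.1.1
    obtain ⟨hlt, hlt'⟩ := (detourDist_lt_top_iff hy hy').1 hδ
    obtain ⟨C, hC⟩ := exists_le_add_of_detourCost_lt_top hy' hlt
    obtain ⟨C', hC'⟩ := exists_le_add_of_detourCost_lt_top hy hlt'
    obtain rfl : J' = J := (subset_of_maxHoro_le_add b hunb hC).antisymm
      (subset_of_maxHoro_le_add b hunb' hC')
    have heq : ∀ j ∈ J', f j = f' j := fun j hj => by
      by_contra hne
      obtain ⟨z, hz⟩ := isBusemannPoint_iff.1 (hfb j hj)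
      obtain ⟨z', hz'⟩ := isBusemannPoint_iff.1 (hfb' j hj)
      exact ((detourDist_lt_top_iff hz.1 hz'.1).2
        ⟨detourCost_lt_top_of_le_add hz (le_add_of_maxHoro_le_add b hunb hC hj hj),
          detourCost_lt_top_of_le_add hz' (le_add_of_maxHoro_le_add b hunb' hC' hj hj)⟩).ne
        (hdet j _ _ (hfb j hj) (hfb' j hj) hne)
    exact ⟨α', hα', funext fun x => Finset.sup'_congr hJ rfl fun j hj => by rw [heq j hj]⟩
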